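/- arXiv:2210.00116 — 2 statements merged into one kernel-verified Lean document; each statement's English description precedes it below -/
import Mathlib

section
/- For all values y', z, y, g, t, x, t' (with the conditioning events having positive probability), the joint conditional pmf factorizes as p(y', z, y, g, t | x, t') = p(y' | g, x, t') · p(z | y', g, x, t') · p(y, t | z, x) · p_G(g). -/
/-- Tuple of values `(g, x, z, t, t', y, y')` for the causal model of Figure 1. -/
structure Tup (𝒢 𝒳 𝒵 𝒯 𝒴 : Type*) where
  g : 𝒢
  x : 𝒳
  z : 𝒵
  t : 𝒯
  t' : 𝒯
  y : 𝒴
  y' : 𝒴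

instance {𝒢 𝒳 𝒵 𝒯 𝒴 : Type*} [Fintype 𝒢] [Fintype 𝒳] [Fintype 𝒵] [Fintype 𝒯] [Fintype 𝒴] :
    Fintype (Tup 𝒢 𝒳 𝒵 𝒯 𝒴) :=
  Fintype.ofEquiv (𝒢 × 𝒳 × 𝒵 × 𝒯 × 𝒯 × 𝒴 × 𝒴)
    { toFun := fun p => ⟨p.1, p.2.1, p.2.2.1, p.2.2.2.1, p.2.2.2.2.1, p.2.2.2.2.2.1, p.2.2.2.2.2.2⟩
      invFun := fun d => (d.g, d.x, d.z, d.t, d.t', d.y, d.y')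
      left_inv := fun _ => rfl
      right_inv := fun _ => rfl }

/-- Probability of an event under a pmf `p` on a finite type. -/
noncomputable def Pr {D : Type*} [Fintype D] (p : D → ℝ) (E : Set D) : ℝ :=
  ∑ d, E.indicator p d

/-- Conditional probability `p(A | B)`, defined as a ratio of marginal sums of `p`. -/
noncomputable def condPr {D : Type*} [Fintype D] (p : D → ℝ) (A B : Set D) : ℝ :=
  Pr p (A ∩ B) / Pr p B

/-- The joint pmf factorizing along the Bayesian network of Figure 1. -/
noncomputable def joint {𝒢 𝒳 𝒵 𝒯 𝒴 : Type*} (pG : 𝒢 → ℝ) (pX : 𝒳 → ℝ)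
    (pT pT' : 𝒯 → 𝒳 → ℝ) (pZ : 𝒵 → 𝒢 → 𝒳 → ℝ) (pO : 𝒴 → 𝒵 → 𝒯 → ℝ)
    (d : Tup 𝒢 𝒳 𝒵 𝒯 𝒴) : ℝ :=
  pG d.g * pX d.x * pT d.t d.x * pT' d.t' d.x * pZ d.z d.g d.x * pO d.y d.z d.t * pO d.y' d.z d.t'

lemma Pr_box {𝒢 𝒳 𝒵 𝒯 𝒴 : Type*} [Fintype 𝒢] [Fintype 𝒳] [Fintype 𝒵] [Fintype 𝒯] [Fintype 𝒴]
    (p : Tup 𝒢 𝒳 𝒵 𝒯 𝒴 → ℝ) (E : Set (Tup 𝒢 𝒳 𝒵 𝒯 𝒴))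
    (A : Finset 𝒢) (B : Finset 𝒳) (C : Finset 𝒵) (D D' : Finset 𝒯) (F F' : Finset 𝒴)
    (hE : ∀ d, d ∈ E ↔ d.g ∈ A ∧ d.x ∈ B ∧ d.z ∈ C ∧ d.t ∈ D ∧ d.t' ∈ D' ∧ d.y ∈ F ∧ d.y' ∈ F') :
    Pr p E = ∑ g ∈ A, ∑ x ∈ B, ∑ z ∈ C, ∑ t' ∈ D', ∑ y' ∈ F', ∑ t ∈ D, ∑ y ∈ F,
      p ⟨g, x, z, t, t', y, y'⟩ := by
  classical
  simp only [Pr, Set.indicator_apply]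
  rw [← Finset.sum_filter]
  simp only [← Finset.sum_product']
  refine Finset.sum_bij' (fun d _ => (d.g, d.x, d.z, d.t', d.y', d.t, d.y))
    (fun q _ => ⟨q.1, q.2.1, q.2.2.1, q.2.2.2.2.2.1, q.2.2.2.1, q.2.2.2.2.2.2, q.2.2.2.2.1⟩)
    ?_ ?_ ?_ ?_ ?_
  · intro d hd
    simp only [Finset.mem_filter, hE, Finset.mem_product] at hd ⊢
    tauto
  · intro d hd
    simp only [Finset.mem_filter, hE, Finset.mem_product, Finset.mem_univ] at hd ⊢
    tauto
  · intros; rfl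
  · intros; rfl
  · intros; rfl

/-- The joint conditional pmf factorizes as
`p(y', z, y, g, t | x, t') = p(y' | g, x, t') · p(z | y', g, x, t') · p(y, t | z, x) · p_G(g)`. -/
theorem joint_conditional_factorization
    {𝒢 𝒳 𝒵 𝒯 𝒴 : Type*} [Fintype 𝒢] [Fintype 𝒳] [Fintype 𝒵] [Fintype 𝒯] [Fintype 𝒴]
    [Nonempty 𝒢] [Nonempty 𝒳] [Nonempty 𝒵] [Nonempty 𝒯] [Nonempty 𝒴]
    (pG : 𝒢 → ℝ) (pX : 𝒳 → ℝ) (pT pT' : 𝒯 → 𝒳 → ℝ)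
    (pZ : 𝒵 → 𝒢 → 𝒳 → ℝ) (pO : 𝒴 → 𝒵 → 𝒯 → ℝ)
    (p : Tup 𝒢 𝒳 𝒵 𝒯 𝒴 → ℝ)
    (hp : ∀ d, p d = joint pG pX pT pT' pZ pO d)
    (hpG0 : ∀ g, 0 ≤ pG g) (hpG1 : ∑ g, pG g = 1)
    (hpX0 : ∀ x, 0 ≤ pX x) (hpX1 : ∑ x, pX x = 1)
    (hpT0 : ∀ t x, 0 ≤ pT t x) (hpT1 : ∀ x, ∑ t, pT t x = 1)
    (hpT'0 : ∀ t x, 0 ≤ pT' t x) (hpT'1 : ∀ x, ∑ t, pT' t x = 1)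
    (hpZ0 : ∀ z g x, 0 ≤ pZ z g x) (hpZ1 : ∀ g x, ∑ z, pZ z g x = 1)
    (hpO0 : ∀ y z t, 0 ≤ pO y z t) (hpO1 : ∀ z t, ∑ y, pO y z t = 1)
    (hpos : ∀ d, 0 < p d)
    (y' : 𝒴) (z : 𝒵) (y : 𝒴) (g : 𝒢) (t : 𝒯) (x : 𝒳) (t' : 𝒯) :
    condPr p {d | d.y' = y' ∧ d.z = z ∧ d.y = y ∧ d.g = g ∧ d.t = t} {d | d.x = x ∧ d.t' = t'}
      = condPr p {d | d.y' = y'} {d | d.g = g ∧ d.x = x ∧ d.t' = t'}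
        * condPr p {d | d.z = z} {d | d.y' = y' ∧ d.g = g ∧ d.x = x ∧ d.t' = t'}
        * condPr p {d | d.y = y ∧ d.t = t} {d | d.z = z ∧ d.x = x}
        * pG g := by
  have e : ∀ g x z t' y', ∑ t, ∑ y, pG g * pX x * pT t x * pT' t' x * pZ z g x * pO y z t
        * pO y' z t' = pG g * pX x * pT' t' x * pZ z g x * pO y' z t' := by
    intro g x z t' y'
    have : ∀ t, ∑ y, pG g * pX x * pT t x * pT' t' x * pZ z g x * pO y z t * pO y' z t'
          = pT t x * (pG g * pX x * pT' t' x * pZ z g x * pO y' z t') := by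
      intro t
      rw [← Finset.sum_mul, ← Finset.mul_sum, hpO1]; ring
    simp only [this]
    rw [← Finset.sum_mul, hpT1, one_mul]
  have h1 : Pr p ({d | d.y' = y' ∧ d.z = z ∧ d.y = y ∧ d.g = g ∧ d.t = t} ∩ {d | d.x = x ∧ d.t' = t'}) = pG g * pX x * pT t x * pT' t' x * pZ z g x * pO y z t * pO y' z t' := by
    rw [Pr_box p _ {g} {x} {z} {t} {t'} {y} {y'} (by intro d; simp; try tauto)]
    simp only [Finset.sum_singleton, hp, joint]

  have h2 : Pr p {d | d.x = x ∧ d.t' = t'} = pX x * pT' t' x := by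
    rw [Pr_box p _ Finset.univ {x} Finset.univ Finset.univ {t'} Finset.univ Finset.univ (by intro d; simp; try tauto)]
    simp only [Finset.sum_singleton, hp, joint, e]
    simp only [← Finset.mul_sum, hpO1, hpZ1, mul_one]
    simp only [← Finset.sum_mul, ← Finset.mul_sum, hpZ1, mul_one, hpG1, one_mul]
  have h3 : Pr p {d | d.y' = y' ∧ d.g = g ∧ d.x = x ∧ d.t' = t'} = pG g * pX x * pT' t' x * (∑ z, pZ z g x * pO y' z t') := by
    rw [Pr_box p _ {g} {x} Finset.univ Finset.univ {t'} Finset.univ {y'} (by intro d; simp; try tauto)]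
    simp only [Finset.sum_singleton, hp, joint, e]
    rw [Finset.mul_sum]
    exact Finset.sum_congr rfl fun _ _ => by ring
  have h3' : Pr p ({d | d.y' = y'} ∩ {d | d.g = g ∧ d.x = x ∧ d.t' = t'})
      = pG g * pX x * pT' t' x * (∑ z, pZ z g x * pO y' z t') := h3
  have h4 : Pr p {d | d.g = g ∧ d.x = x ∧ d.t' = t'} = pG g * pX x * pT' t' x := by
    rw [Pr_box p _ {g} {x} Finset.univ Finset.univ {t'} Finset.univ Finset.univ (by intro d; simp; try tauto)]
    simp only [Finset.sum_singleton, hp, joint, e]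
    simp only [← Finset.mul_sum, hpO1, hpZ1, mul_one]
  have h5 : Pr p ({d | d.z = z} ∩ {d | d.y' = y' ∧ d.g = g ∧ d.x = x ∧ d.t' = t'}) = pG g * pX x * pT' t' x * pZ z g x * pO y' z t' := by
    rw [Pr_box p _ {g} {x} {z} Finset.univ {t'} Finset.univ {y'} (by intro d; simp; try tauto)]
    simp only [Finset.sum_singleton, hp, joint, e]

  have h6 : Pr p ({d | d.y = y ∧ d.t = t} ∩ {d | d.z = z ∧ d.x = x}) = pX x * pT t x * pO y z t * (∑ g, pG g * pZ z g x) := by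
    rw [Pr_box p _ Finset.univ {x} {z} {t} Finset.univ {y} Finset.univ (by intro d; simp; try tauto)]
    simp only [Finset.sum_singleton, hp, joint]
    simp only [← Finset.mul_sum, hpO1, mul_one]
    rw [Finset.mul_sum]
    refine Finset.sum_congr rfl fun g _ => ?_
    rw [← Finset.sum_mul, ← Finset.sum_mul, ← Finset.mul_sum, hpT'1]; ring
  have h7 : Pr p {d | d.z = z ∧ d.x = x} = pX x * (∑ g, pG g * pZ z g x) := by
    rw [Pr_box p _ Finset.univ {x} {z} Finset.univ Finset.univ Finset.univ Finset.univ (by intro d; simp; try tauto)]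
    simp only [Finset.sum_singleton, hp, joint, e]
    simp only [← Finset.mul_sum, hpO1, mul_one]
    rw [Finset.mul_sum]
    refine Finset.sum_congr rfl fun g _ => ?_
    rw [← Finset.sum_mul, ← Finset.mul_sum, hpT'1]; ring
  have hne : ∀ g z, pG g ≠ 0 ∧ pX x ≠ 0 ∧ pT' t' x ≠ 0 ∧ pZ z g x ≠ 0 ∧ pO y' z t' ≠ 0 := by
    intro g z
    have := (hpos ⟨g, x, z, t, t', y, y'⟩).ne'
    rw [hp] at this
    simp only [joint, mul_ne_zero_iff] at this
    tauto
  have hS : (∑ z, pZ z g x * pO y' z t') ≠ 0 := by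
    refine (Finset.sum_pos (fun z _ => ?_) Finset.univ_nonempty).ne'
    obtain ⟨_, _, _, a, b⟩ := hne g z
    exact mul_pos ((hpZ0 _ _ _).lt_of_ne' a) ((hpO0 _ _ _).lt_of_ne' b)
  have hQ : (∑ g, pG g * pZ z g x) ≠ 0 := by
    refine (Finset.sum_pos (fun g _ => ?_) Finset.univ_nonempty).ne'
    obtain ⟨a, _, _, b, _⟩ := hne g z
    exact mul_pos ((hpG0 _).lt_of_ne' a) ((hpZ0 _ _ _).lt_of_ne' b)
  obtain ⟨a1, a2, a3, a4, a5⟩ := hne g z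
  unfold condPr
  rw [h1, h2, h3', h3, h4, h5, h6, h7]
  generalize (∑ z, pZ z g x * pO y' z t') = S at *
  generalize (∑ g, pG g * pZ z g x) = Q at *
  field_simp
end

section
/- For every treatment value a ∈ 𝒯, every outcome value y' and every (g, x) with positive probability, the conditional pmf of the counterfactual outcome coincides with that of the factual outcome: p(Y' = y' | g, x, T' = a) = p(Y = y' | g, x, T = a); i.e., the counterfactual response distribution given (G, X, T' = a) is identical to the observed response distribution given (G, X, T = a). -/
theorem sum_tup {𝒢 𝒳 𝒵 𝒯 𝒴 : Type*} [Fintype 𝒢] [Fintype 𝒳] [Fintype 𝒵] [Fintype 𝒯] [Fintype 𝒴]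
    (f : Tup 𝒢 𝒳 𝒵 𝒯 𝒴 → ℝ) :
    ∑ d, f d = ∑ g, ∑ x, ∑ z, ∑ t, ∑ t', ∑ y, ∑ y', f ⟨g, x, z, t, t', y, y'⟩ := by
  let e : (𝒢 × 𝒳 × 𝒵 × 𝒯 × 𝒯 × 𝒴 × 𝒴) ≃ Tup 𝒢 𝒳 𝒵 𝒯 𝒴 :=
    { toFun := fun p => ⟨p.1, p.2.1, p.2.2.1, p.2.2.2.1, p.2.2.2.2.1, p.2.2.2.2.2.1, p.2.2.2.2.2.2⟩
      invFun := fun d => (d.g, d.x, d.z, d.t, d.t', d.y, d.y')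
      left_inv := fun _ => rfl
      right_inv := fun _ => rfl }
  rw [← e.sum_comp]
  simp only [Fintype.sum_prod_type]
  rfl

open Classical in
theorem marg' {𝒢 𝒳 𝒵 𝒯 𝒴 : Type*} [Fintype 𝒢] [Fintype 𝒳] [Fintype 𝒵] [Fintype 𝒯] [Fintype 𝒴]
    (pG : 𝒢 → ℝ) (pX : 𝒳 → ℝ) (pT pT' : 𝒯 → 𝒳 → ℝ)
    (pZ : 𝒵 → 𝒢 → 𝒳 → ℝ) (pO : 𝒴 → 𝒵 → 𝒯 → ℝ)
    (hpT1 : ∀ x, ∑ t, pT t x = 1) (hpO1 : ∀ z t, ∑ y, pO y z t = 1)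
    (w : 𝒴 → ℝ) (a : 𝒯) (g : 𝒢) (x : 𝒳) :
    ∑ d : Tup 𝒢 𝒳 𝒵 𝒯 𝒴, (if d.g = g then 1 else 0) * ((if d.x = x then 1 else 0) *
      ((if d.t' = a then 1 else 0) * (w d.y' * joint pG pX pT pT' pZ pO d)))
      = pG g * pX x * pT' a x * ∑ z, pZ z g x * ∑ y, w y * pO y z a := by
  rw [sum_tup]
  change ∑ g', ∑ x', ∑ z, ∑ t, ∑ t', ∑ y, ∑ v, (if g' = g then (1 : ℝ) else 0) *
    ((if x' = x then 1 else 0) * ((if t' = a then 1 else 0) * (w v *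
      (pG g' * pX x' * pT t x' * pT' t' x' * pZ z g' x' * pO y z t * pO v z t')))) = _
  simp only [← Finset.mul_sum]
  simp only [ite_mul, one_mul, zero_mul, Finset.sum_ite_eq',
    Finset.mem_univ, if_true]
  rw [Finset.mul_sum]
  refine Finset.sum_congr rfl fun z _ => ?_
  have h : ∀ t, ∑ y, ∑ v, w v * (pG g * pX x * pT t x * pT' a x * pZ z g x * pO y z t * pO v z a)
      = pT t x * (pG g * pX x * pT' a x * (pZ z g x * ∑ v, w v * pO v z a)) := by
    intro t
    have : ∀ y, ∑ v, w v * (pG g * pX x * pT t x * pT' a x * pZ z g x * pO y z t * pO v z a)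
      = pO y z t * (pT t x * (pG g * pX x * pT' a x * (pZ z g x * ∑ v, w v * pO v z a))) := by
      intro y
      simp only [Finset.mul_sum]
      exact Finset.sum_congr rfl fun v _ => by ring
    simp only [this]
    rw [← Finset.sum_mul, hpO1, one_mul]
  simp only [h]
  rw [← Finset.sum_mul, hpT1, one_mul]

theorem sum_swap {𝒢 𝒳 𝒵 𝒯 𝒴 : Type*} [Fintype 𝒢] [Fintype 𝒳] [Fintype 𝒵] [Fintype 𝒯] [Fintype 𝒴]
    (f : Tup 𝒢 𝒳 𝒵 𝒯 𝒴 → ℝ) :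
    ∑ d, f d = ∑ d : Tup 𝒢 𝒳 𝒵 𝒯 𝒴, f ⟨d.g, d.x, d.z, d.t', d.t, d.y', d.y⟩ := by
  let e : Tup 𝒢 𝒳 𝒵 𝒯 𝒴 ≃ Tup 𝒢 𝒳 𝒵 𝒯 𝒴 :=
    { toFun := fun d => ⟨d.g, d.x, d.z, d.t', d.t, d.y', d.y⟩
      invFun := fun d => ⟨d.g, d.x, d.z, d.t', d.t, d.y', d.y⟩
      left_inv := fun _ => rfl
      right_inv := fun _ => rfl }
  exact (e.sum_comp f).symm

open Classical in
theorem cond' {𝒢 𝒳 𝒵 𝒯 𝒴 : Type*} [Fintype 𝒢] [Fintype 𝒳] [Fintype 𝒵] [Fintype 𝒯] [Fintype 𝒴]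
    (pG : 𝒢 → ℝ) (pX : 𝒳 → ℝ) (pT pT' : 𝒯 → 𝒳 → ℝ)
    (pZ : 𝒵 → 𝒢 → 𝒳 → ℝ) (pO : 𝒴 → 𝒵 → 𝒯 → ℝ)
    (hpT1 : ∀ x, ∑ t, pT t x = 1) (hpZ1 : ∀ g x, ∑ z, pZ z g x = 1)
    (hpO1 : ∀ z t, ∑ y, pO y z t = 1)
    (a : 𝒯) (y' : 𝒴) (g : 𝒢) (x : 𝒳) (h0 : pG g * pX x * pT' a x ≠ 0) :
    condPr (joint pG pX pT pT' pZ pO) {d | d.y' = y'} {d | d.g = g ∧ d.x = x ∧ d.t' = a}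
      = ∑ z, pZ z g x * pO y' z a := by
  have h1 := marg' pG pX pT pT' pZ pO hpT1 hpO1 (fun y => if y = y' then 1 else 0) a g x
  have h2 := marg' pG pX pT pT' pZ pO hpT1 hpO1 (fun _ => 1) a g x
  simp only [one_mul, hpO1, mul_one, hpZ1] at h2
  simp only [ite_mul, one_mul, zero_mul, Finset.sum_ite_eq', Finset.mem_univ, if_true] at h1
  have e1 : Pr (joint pG pX pT pT' pZ pO)
      ({d | d.y' = y'} ∩ {d | d.g = g ∧ d.x = x ∧ d.t' = a}) =
      pG g * pX x * pT' a x * ∑ z, pZ z g x * pO y' z a := by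
    rw [← h1, Pr]
    refine Finset.sum_congr rfl fun d _ => ?_
    simp only [Set.indicator_apply, Set.mem_inter_iff, Set.mem_ofPred_eq]
    split_ifs <;> first | rfl | tauto
  have e2 : Pr (joint pG pX pT pT' pZ pO) {d | d.g = g ∧ d.x = x ∧ d.t' = a} =
      pG g * pX x * pT' a x := by
    rw [← h2, Pr]
    refine Finset.sum_congr rfl fun d _ => ?_
    simp only [Set.indicator_apply, Set.mem_ofPred_eq, ite_mul, one_mul, zero_mul]
    split_ifs <;> first | rfl | tauto
  rw [condPr, e1, e2, mul_div_cancel_left₀ _ h0]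

/-- The counterfactual response distribution given `(G, X, T' = a)` is identical to the observed
response distribution given `(G, X, T = a)`:
`p(Y' = y' | g, x, T' = a) = p(Y = y' | g, x, T = a)`. -/
theorem counterfactual_response_eq_factual_response
    {𝒢 𝒳 𝒵 𝒯 𝒴 : Type*} [Fintype 𝒢] [Fintype 𝒳] [Fintype 𝒵] [Fintype 𝒯] [Fintype 𝒴]
    [Nonempty 𝒢] [Nonempty 𝒳] [Nonempty 𝒵] [Nonempty 𝒯] [Nonempty 𝒴]
    (pG : 𝒢 → ℝ) (pX : 𝒳 → ℝ) (pT pT' : 𝒯 → 𝒳 → ℝ)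
    (pZ : 𝒵 → 𝒢 → 𝒳 → ℝ) (pO : 𝒴 → 𝒵 → 𝒯 → ℝ)
    (p : Tup 𝒢 𝒳 𝒵 𝒯 𝒴 → ℝ)
    (hp : ∀ d, p d = joint pG pX pT pT' pZ pO d)
    (hpG0 : ∀ g, 0 ≤ pG g) (hpG1 : ∑ g, pG g = 1)
    (hpX0 : ∀ x, 0 ≤ pX x) (hpX1 : ∑ x, pX x = 1)
    (hpT0 : ∀ t x, 0 ≤ pT t x) (hpT1 : ∀ x, ∑ t, pT t x = 1)
    (hpT'0 : ∀ t x, 0 ≤ pT' t x) (hpT'1 : ∀ x, ∑ t, pT' t x = 1)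
    (hpZ0 : ∀ z g x, 0 ≤ pZ z g x) (hpZ1 : ∀ g x, ∑ z, pZ z g x = 1)
    (hpO0 : ∀ y z t, 0 ≤ pO y z t) (hpO1 : ∀ z t, ∑ y, pO y z t = 1)
    (hpos : ∀ d, 0 < p d)
    (a : 𝒯) (y' : 𝒴) (g : 𝒢) (x : 𝒳) :
    condPr p {d | d.y' = y'} {d | d.g = g ∧ d.x = x ∧ d.t' = a}
      = condPr p {d | d.y = y'} {d | d.g = g ∧ d.x = x ∧ d.t = a} := by
  obtain rfl : p = joint pG pX pT pT' pZ pO := funext hp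
  obtain ⟨z⟩ := ‹Nonempty 𝒵›
  have hd := (hpos ⟨g, x, z, a, a, y', y'⟩).ne'
  simp only [joint, mul_ne_zero_iff] at hd
  obtain ⟨⟨⟨⟨⟨⟨n1, n2⟩, n3⟩, n4⟩, -⟩, -⟩, -⟩ := hd
  have hs : condPr (joint pG pX pT pT' pZ pO) {d | d.y = y'} {d | d.g = g ∧ d.x = x ∧ d.t = a}
      = condPr (joint pG pX pT' pT pZ pO) {d | d.y' = y'}
        {d | d.g = g ∧ d.x = x ∧ d.t' = a} := by
    have hj : ∀ d : Tup 𝒢 𝒳 𝒵 𝒯 𝒴,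
        joint pG pX pT pT' pZ pO ⟨d.g, d.x, d.z, d.t', d.t, d.y', d.y⟩ =
          joint pG pX pT' pT pZ pO d := by
      intro d
      simp only [joint]
      ring
    classical
    unfold condPr Pr
    congr 1 <;>
    · rw [sum_swap]
      refine Finset.sum_congr rfl fun d _ => ?_
      simp only [Set.indicator_apply, Set.mem_inter_iff, Set.mem_ofPred_eq, hj]
  rw [hs, cond' pG pX pT pT' pZ pO hpT1 hpZ1 hpO1 a y' g x (mul_ne_zero (mul_ne_zero n1 n2) n4),
    cond' pG pX pT' pT pZ pO hpT'1 hpZ1 hpO1 a y' g x (mul_ne_zero (mul_ne_zero n1 n2) n3)]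
end
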